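/- Lower bound for the implicit quadratic finite-difference recursion (equation (4.7)/(4.11) in the paper). Let c̄ > 0, θ* > 0, T > 0, n ∈ ℕ, τ = T/n, and let v₀, v₁, …, v_n be positive real numbers with v₀ = θ* and v_k = v_{k−1} − τ c̄ v_k² for k = 1,…,n. Then the sequence (v_k) is nonincreasing and v_k ≥ (c̄ k τ + 1/θ*)^{−1} for every k = 0,…,n; in particular v_k ≥ θ̃ := (c̄ T + 1/θ*)^{−1} > 0 for all k = 0,…,n. -/

import Mathlib

/-!
Lower bound for the implicit quadratic finite-difference recursion
`v_k = v_{k-1} - τ c̄ v_k²`, `v₀ = θ*`, `τ = T/n`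
(equations (4.7)/(4.11) in Lazzaroni–Rossi–Thomas–Toader):
the sequence is nonincreasing, `v_k ≥ (c̄ k τ + 1/θ*)⁻¹`, and in particular
`v_k ≥ θ̃ := (c̄ T + 1/θ*)⁻¹ > 0` for all `k = 0, …, n`.
-/
theorem recursion_lower_bound
    (cbar θstar T : ℝ) (hc : 0 < cbar) (hθ : 0 < θstar) (hT : 0 < T)
    (n : ℕ) (hn : 0 < n) (v : ℕ → ℝ)
    (hpos : ∀ k ≤ n, 0 < v k)
    (h0 : v 0 = θstar)
    (hrec : ∀ k, 1 ≤ k → k ≤ n → v k = v (k - 1) - (T / n) * cbar * (v k) ^ 2) :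
    (∀ k l, k ≤ l → l ≤ n → v l ≤ v k) ∧
    (∀ k ≤ n, (cbar * k * (T / n) + 1 / θstar)⁻¹ ≤ v k) ∧
    (0 < (cbar * T + 1 / θstar)⁻¹ ∧ ∀ k ≤ n, (cbar * T + 1 / θstar)⁻¹ ≤ v k) := by
  have hn' : (0 : ℝ) < n := by exact_mod_cast hn
  have hτ : 0 < T / n := div_pos hT hn'
  have step : ∀ k, k + 1 ≤ n → v k = v (k + 1) + T / n * cbar * v (k + 1) ^ 2 := by
    intro k hk
    have h := hrec (k + 1) (by omega) hk
    rw [Nat.add_sub_cancel] at h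
    linarith
  have mono1 : ∀ k, k + 1 ≤ n → v (k + 1) ≤ v k := by
    intro k hk
    have h1 : 0 ≤ T / n * cbar * v (k + 1) ^ 2 := by positivity
    have h2 := step k hk
    linarith
  have inv_bound : ∀ k, k ≤ n → (v k)⁻¹ ≤ cbar * k * (T / n) + 1 / θstar := by
    intro k
    induction k with
    | zero => intro _; simp [h0]
    | succ k ih =>
      intro hk
      have ha := hpos k (by omega)
      have hb := hpos (k + 1) hk
      have ih' := ih (by omega)
      have hs := step k hk
      have hm := mono1 k hk
      have key : (v (k + 1))⁻¹ ≤ (v k)⁻¹ + T / n * cbar := by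
        have e : (v k)⁻¹ + T / n * cbar - (v (k + 1))⁻¹
            = T / n * cbar * v (k + 1) * (v k - v (k + 1)) / (v k * v (k + 1)) := by
          generalize T / (n : ℝ) = τ at *
          rw [eq_div_iff (by positivity)]
          have e1 : (v k)⁻¹ * v k = 1 := inv_mul_cancel₀ ha.ne'
          have e2 : (v (k + 1))⁻¹ * v (k + 1) = 1 := inv_mul_cancel₀ hb.ne'
          linear_combination v (k + 1) * e1 - v k * e2 - hs
        have h3 : 0 ≤ T / n * cbar * v (k + 1) * (v k - v (k + 1)) / (v k * v (k + 1)) := by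
          have := sub_nonneg.2 hm
          positivity
        linarith
      push_cast
      linarith
  have hbd : ∀ k ≤ n, (cbar * k * (T / n) + 1 / θstar)⁻¹ ≤ v k := by
    intro k hk
    exact inv_le_of_inv_le₀ (hpos k hk) (inv_bound k hk)
  refine ⟨?_, hbd, by positivity, ?_⟩
  · intro k l hkl
    induction l, hkl using Nat.le_induction with
    | base => intro _; exact le_rfl
    | succ l _ ih => intro hl; exact (mono1 l hl).trans (ih (by omega))
  · intro k hk
    refine inv_le_of_inv_le₀ (hpos k hk) ((inv_bound k hk).trans ?_)
    have hk' : (k : ℝ) ≤ n := by exact_mod_cast hk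
    have e : cbar * T = cbar * n * (T / n) := by field_simp
    rw [e]
    gcongr
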